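/- arXiv:0907.3859 — 3 statements merged into one kernel-verified Lean document; each statement's English description precedes it below -/
import Mathlib

section
/- Let P(λ) = A_m λ^m + ⋯ + A_1 λ + A_0 be an n×n complex matrix polynomial with det A_m ≠ 0, and let λ0 ∈ ℂ be an eigenvalue of P (i.e. det P(λ0) = 0) such that the matrix P'(λ0) is invertible, where P'(λ) = Σ_{j=1}^m j A_j λ^{j−1}. Let x0, y0 ∈ ℂ^n be unit right and left eigenvectors, i.e. P(λ0) x0 = 0, y0* P(λ0) = 0, ‖x0‖ = ‖y0‖ = 1. If y0* P'(λ0) x0 = 0, then λ0 is a multiple eigenvalue of P, i.e. λ0 is a root of the scalar polynomial det P(λ) of multiplicity at least 2. -/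
noncomputable section

open Matrix

/-- Euclidean norm of a complex vector. -/
def enorm2 {n : ℕ} (x : Fin n → ℂ) : ℝ := Real.sqrt (∑ i, ‖x i‖ ^ 2)

/-- Spectral norm: the operator norm induced by the Euclidean vector norm. -/
def specNorm {n : ℕ} (A : Matrix (Fin n) (Fin n) ℂ) : ℝ :=
  sSup {r : ℝ | ∃ x : Fin n → ℂ, enorm2 x = 1 ∧ r = enorm2 (A.mulVec x)}

/-- Smallest singular value: the minimum of `‖A x‖` over Euclidean-unit vectors `x`. -/
def sminSV {n : ℕ} (A : Matrix (Fin n) (Fin n) ℂ) : ℝ :=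
  sInf {r : ℝ | ∃ x : Fin n → ℂ, enorm2 x = 1 ∧ r = enorm2 (A.mulVec x)}

/-- Evaluation of the matrix polynomial `P(z) = ∑ A_j z^j`. -/
def evalP {n m : ℕ} (A : Fin (m+1) → Matrix (Fin n) (Fin n) ℂ) (z : ℂ) :
    Matrix (Fin n) (Fin n) ℂ :=
  ∑ j : Fin (m+1), z ^ (j : ℕ) • A j

/-- Derivative `P'(z) = ∑_{j≥1} j A_j z^(j-1)`. -/
def derivP {n m : ℕ} (A : Fin (m+1) → Matrix (Fin n) (Fin n) ℂ) (z : ℂ) :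
    Matrix (Fin n) (Fin n) ℂ :=
  ∑ j : Fin (m+1), (((j : ℕ) : ℂ) * z ^ ((j : ℕ) - 1)) • A j

/-- The scalar polynomial `det P(λ)`. -/
def detPoly {n m : ℕ} (A : Fin (m+1) → Matrix (Fin n) (Fin n) ℂ) : Polynomial ℂ :=
  (Matrix.of fun i k => ∑ j : Fin (m+1), Polynomial.C (A j i k) * Polynomial.X ^ (j : ℕ)).det

/-- The weight polynomial `w(t) = ∑ w_j t^j`. -/
def wval {m : ℕ} (w : Fin (m+1) → ℝ) (t : ℝ) : ℝ := ∑ j : Fin (m+1), w j * t ^ (j : ℕ)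

open Polynomial in
lemma aux_dvd {n : ℕ} (R : Matrix (Fin n) (Fin n) ℂ[X]) (a : ℂ) (i0 k0 : Fin n)
    (hrow : ∀ k, (R i0 k).eval a = 0) (hcol : ∀ i, (R i k0).eval a = 0)
    (hd : (X - C a) ^ 2 ∣ R i0 k0) : (X - C a) ^ 2 ∣ R.det := by
  rw [Matrix.det_eq_sum_mul_adjugate_row R i0]
  refine Finset.dvd_sum fun k _ => ?_
  by_cases hk : k = k0
  · subst hk
    exact hd.mul_right _
  · rw [pow_two]
    refine mul_dvd_mul (dvd_iff_isRoot.2 (hrow k)) (dvd_iff_isRoot.2 ?_)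
    rw [IsRoot, Matrix.adjugate_apply, ← coe_evalRingHom, RingHom.map_det]
    refine Matrix.det_eq_zero_of_column_eq_zero k0 fun i => ?_
    by_cases hi : i = i0
    · subst hi
      simp [Matrix.updateRow_self, Ne.symm hk]
    · simp [Matrix.updateRow_ne hi, hcol]

open Polynomial in
lemma aux_sq {q : ℂ[X]} {a : ℂ} (h0 : q.eval a = 0) (h1 : (derivative q).eval a = 0) :
    (X - C a) ^ 2 ∣ q := by
  obtain ⟨r, rfl⟩ := dvd_iff_isRoot.2 h0
  rw [pow_two]
  refine mul_dvd_mul_left _ (dvd_iff_isRoot.2 ?_)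
  simpa [derivative_mul] using h1

lemma aux_detU {R : Type*} [CommRing R] {n : ℕ} (i0 : Fin n) (y : Fin n → R) :
    ((1 : Matrix (Fin n) (Fin n) R).updateRow i0 y).det = y i0 := by
  rw [← Matrix.det_transpose, ← Matrix.updateCol_transpose, Matrix.transpose_one,
    ← Matrix.cramer_apply, Matrix.cramer_one]
  rfl

lemma aux_detV {R : Type*} [CommRing R] {n : ℕ} (i0 : Fin n) (y : Fin n → R) :
    ((1 : Matrix (Fin n) (Fin n) R).updateCol i0 y).det = y i0 := by
  rw [← Matrix.cramer_apply, Matrix.cramer_one]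
  rfl

open Polynomial in
lemma aux_main {n : ℕ} (P : Matrix (Fin n) (Fin n) ℂ[X]) (a : ℂ) (x y : Fin n → ℂ)
    (hx0 : x ≠ 0) (hy0 : y ≠ 0)
    (hx : (P.map (eval a)).mulVec x = 0) (hy : Matrix.vecMul y (P.map (eval a)) = 0)
    (ho : y ⬝ᵥ (P.map fun p => eval a (derivative p)).mulVec x = 0) :
    (X - C a) ^ 2 ∣ P.det := by
  obtain ⟨i0, hi⟩ := Function.ne_iff.1 hy0
  obtain ⟨k0, hk⟩ := Function.ne_iff.1 hx0
  set U : Matrix (Fin n) (Fin n) ℂ := (1 : Matrix (Fin n) (Fin n) ℂ).updateRow i0 y with hU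
  set V : Matrix (Fin n) (Fin n) ℂ := (1 : Matrix (Fin n) (Fin n) ℂ).updateCol k0 x with hV
  have hUr : ∀ j, U i0 j = y j := fun j => by simp [hU]
  have hVc : ∀ j, V j k0 = x j := fun j => by simp [hV]
  have key : (X - C a) ^ 2 ∣ (U.map C * (P * V.map C)).det := by
    apply aux_dvd _ a i0 k0
    · intro k
      have h : ((Matrix.vecMul y (P.map (eval a))) ᵥ* V) k = 0 := by rw [hy]; simp
      rw [Matrix.vecMul_vecMul] at h
      simpa [Matrix.mul_apply, Matrix.vecMul, dotProduct, eval_finsetSum, hUr] using h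
    · intro i
      have h : (U *ᵥ ((P.map (eval a)).mulVec x)) i = 0 := by rw [hx]; simp
      simpa [Matrix.mul_apply, Matrix.mulVec, dotProduct, eval_finsetSum, hVc] using h
    · apply aux_sq
      · have h : y ⬝ᵥ ((P.map (eval a)).mulVec x) = 0 := by rw [hx]; simp
        simpa [Matrix.mul_apply, Matrix.mulVec, dotProduct, eval_finsetSum, hVc, hUr] using h
      · simpa [Matrix.mul_apply, Matrix.mulVec, dotProduct, eval_finsetSum, hVc, hUr,
          derivative_sum, derivative_mul] using ho
  have e1 : (U.map C).det = C (y i0) := by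
    have := RingHom.map_det (C : ℂ →+* ℂ[X]) U
    rw [hU, aux_detU] at this
    exact this.symm
  have e2 : (V.map C).det = C (x k0) := by
    have := RingHom.map_det (C : ℂ →+* ℂ[X]) V
    rw [hV, aux_detV] at this
    exact this.symm
  rw [Matrix.det_mul, Matrix.det_mul, e1, e2] at key
  have u1 : IsUnit (C (y i0)) := isUnit_C.2 (isUnit_iff_ne_zero.2 hi)
  have u2 : IsUnit (C (x k0)) := isUnit_C.2 (isUnit_iff_ne_zero.2 hk)
  rwa [u1.dvd_mul_left, u2.dvd_mul_right] at key

lemma aux_eval {n m : ℕ} (A : Fin (m+1) → Matrix (Fin n) (Fin n) ℂ) (z : ℂ) :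
    (detPoly A).eval z = (evalP A z).det := by
  rw [detPoly, ← Polynomial.coe_evalRingHom, RingHom.map_det]
  congr 1
  ext i k
  simp [evalP, Polynomial.eval_finsetSum, Matrix.sum_apply]
  exact Finset.sum_congr rfl fun j _ => by ring

lemma aux_ne {n m : ℕ} (A : Fin (m+1) → Matrix (Fin n) (Fin n) ℂ)
    (hAm : (A (Fin.last m)).det ≠ 0) : detPoly A ≠ 0 := by
  intro h0
  have hz : ∀ t : ℂ, t ≠ 0 → (evalP (fun j => A j.rev) t).det = 0 := by
    intro t ht
    have e : evalP (fun j => A j.rev) t = t ^ m • evalP A t⁻¹ := by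
      rw [evalP, evalP, Finset.smul_sum, ← Equiv.sum_comp Fin.revPerm]
      refine Finset.sum_congr rfl fun j _ => ?_
      rw [smul_smul]
      have hj : (j : ℕ) ≤ m := Nat.lt_succ_iff.1 j.2
      have : t ^ m * t⁻¹ ^ (j : ℕ) = t ^ (m - (j : ℕ)) := by
        rw [inv_pow, ← pow_sub₀ t ht hj]
      rw [this]
      simp [Fin.val_rev]
    rw [e, Matrix.det_smul, ← aux_eval, h0]
    simp
  have hp : detPoly (fun j => A j.rev) = 0 := by
    have : Polynomial.X * detPoly (fun j => A j.rev) = 0 := by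
      apply Polynomial.funext
      intro t
      by_cases ht : t = 0
      · simp [ht]
      · simp [aux_eval, hz t ht]
    simpa using this
  have := aux_eval (fun j => A j.rev) 0
  rw [hp] at this
  apply hAm
  rw [Polynomial.eval_zero] at this
  rw [this]
  congr 1
  rw [evalP, Fin.sum_univ_succ]
  simp

/-- Proposition 4.1: if `λ0` is an eigenvalue of `P` with `P'(λ0)`
invertible, and the unit right/left eigenvectors satisfy `y0* P'(λ0) x0 = 0`, then `λ0`
is a multiple eigenvalue of `P`. -/
theorem stmt0 {n m : ℕ} (A : Fin (m+1) → Matrix (Fin n) (Fin n) ℂ)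
    (hAm : (A (Fin.last m)).det ≠ 0) (lam0 : ℂ)
    (heig : (evalP A lam0).det = 0)
    (hP' : IsUnit (derivP A lam0))
    (x0 y0 : Fin n → ℂ)
    (hx1 : enorm2 x0 = 1) (hy1 : enorm2 y0 = 1)
    (hx : (evalP A lam0).mulVec x0 = 0)
    (hy : Matrix.vecMul (star y0) (evalP A lam0) = 0)
    (hortho : star y0 ⬝ᵥ (derivP A lam0).mulVec x0 = 0) :
    2 ≤ Polynomial.rootMultiplicity lam0 (detPoly A) := by
  have hx0 : x0 ≠ 0 := by
    rintro rfl
    simp [enorm2] at hx1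
  have hy0 : star y0 ≠ 0 := by
    rw [Ne, star_eq_zero]
    rintro rfl
    simp [enorm2] at hy1
  rw [Polynomial.le_rootMultiplicity_iff (aux_ne A hAm)]
  have e1 : (Matrix.of fun i k => ∑ j : Fin (m+1),
      Polynomial.C (A j i k) * Polynomial.X ^ (j : ℕ)).map (Polynomial.eval lam0)
      = evalP A lam0 := by
    ext i k
    simp [evalP, Polynomial.eval_finsetSum, Matrix.sum_apply]
    exact Finset.sum_congr rfl fun j _ => by ring
  have e2 : ((Matrix.of fun i k => ∑ j : Fin (m+1),
      Polynomial.C (A j i k) * Polynomial.X ^ (j : ℕ)).map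
      fun p => Polynomial.eval lam0 (Polynomial.derivative p))
      = derivP A lam0 := by
    ext i k
    simp [derivP, Polynomial.eval_finsetSum, Matrix.sum_apply,
      Polynomial.derivative_sum, Polynomial.derivative_X_pow]
    exact Finset.sum_congr rfl fun j _ => by ring
  exact aux_main _ lam0 x0 (star y0) hx0 hy0 (by rw [e1]; exact hx) (by rw [e1]; exact hy)
    (by rw [e2]; exact hortho)
end
end

section
/- Let A be an n×n complex matrix (n ≥ 1) that has 0 as a simple eigenvalue, i.e. 0 is a root of multiplicity exactly 1 of the characteristic polynomial of A. Let s_1 ≥ s_2 ≥ ⋯ ≥ s_n ≥ 0 be the singular values of A in decreasing order. Then s_n = 0, s_{n−1} > 0, and ‖adj(A)‖ = s_1 s_2 ⋯ s_{n−1}, where adj denotes the adjugate matrix and ‖·‖ the spectral norm. -/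
noncomputable section

open Matrix

open scoped Matrix.Norms.L2Operator in
lemma specNorm_eq_norm {n : ℕ} (hn : 1 ≤ n) (A : Matrix (Fin n) (Fin n) ℂ) :
    specNorm A = ‖A‖ := by
  haveI : Nonempty (Fin n) := ⟨⟨0, by omega⟩⟩
  rw [Matrix.cstar_norm_def, ← ContinuousLinearMap.sSup_sphere_eq_norm]
  unfold specNorm
  congr 1
  ext r
  simp only [Set.mem_setOf_eq, Set.mem_image, mem_sphere_zero_iff_norm]
  constructor
  · rintro ⟨x, hx, rfl⟩
    refine ⟨WithLp.toLp 2 x, ?_, ?_⟩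
    · rw [EuclideanSpace.norm_eq]; exact hx
    · rw [EuclideanSpace.norm_eq]; rfl
  · rintro ⟨x, hx, rfl⟩
    refine ⟨x.ofLp, ?_, ?_⟩
    · rw [EuclideanSpace.norm_eq] at hx; exact hx
    · rw [EuclideanSpace.norm_eq]; rfl

open Polynomial in
lemma adjugate_ne_zero_of_simple {n : ℕ} (hn : 1 ≤ n) (A : Matrix (Fin n) (Fin n) ℂ)
    (h : Polynomial.rootMultiplicity 0 (Matrix.charpoly A) = 1) : adjugate A ≠ 0 := by
  intro hA
  have hne : A.charpoly ≠ 0 := A.charpoly_monic.ne_zero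
  have h0 : (Polynomial.evalRingHom (0 : ℂ)).mapMatrix (adjugate (charmatrix A)) = 0 := by
    rw [RingHom.map_adjugate]
    have : (Polynomial.evalRingHom (0 : ℂ)).mapMatrix (charmatrix A) = (-1 : ℂ) • A := by
      ext i j
      by_cases hij : i = j
      · subst hij; simp [charmatrix_apply_eq]
      · simp [charmatrix_apply_ne _ _ _ hij]
    rw [this, adjugate_smul, hA, smul_zero]
  have h1 : ∀ i j, (X : ℂ[X]) ∣ adjugate (charmatrix A) i j := by
    intro i j
    rw [Polynomial.X_dvd_iff, Polynomial.coeff_zero_eq_eval_zero]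
    have := congrFun (congrFun h0 i) j
    simpa using this
  choose N hN using h1
  have h2 : adjugate (charmatrix A) = (X : ℂ[X]) • (Matrix.of N) := by
    ext1 i j
    rw [hN]; simp
  have h3 := det_adjugate (charmatrix A)
  rw [h2, det_smul, Fintype.card_fin] at h3
  change _ = A.charpoly ^ (n - 1) at h3
  have h4 : (X : ℂ[X]) ^ n ∣ A.charpoly ^ (n - 1) := ⟨_, h3.symm⟩
  have h5 : (X - C (0 : ℂ)) ^ n ∣ A.charpoly ^ (n - 1) := by simpa using h4
  rw [← Polynomial.le_rootMultiplicity_iff (pow_ne_zero _ hne)] at h5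
  rw [← Polynomial.count_roots, Polynomial.roots_pow, Multiset.count_nsmul,
    Polynomial.count_roots, h] at h5
  omega

open scoped Matrix.Norms.L2Operator in
lemma norm_adjugate_sq {n : ℕ} (A : Matrix (Fin n) (Fin n) ℂ) :
    ‖adjugate A‖ * ‖adjugate A‖ =
      ‖(fun i => ∏ j ∈ Finset.univ.erase i,
        (((Matrix.isHermitian_conjTranspose_mul_self A).eigenvalues j : ℝ) : ℂ))‖ := by
  have hH := Matrix.isHermitian_conjTranspose_mul_self A
  have e1 : adjugate A * star (adjugate A) = adjugate (Aᴴ * A) := by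
    rw [adjugate_mul_distrib, star_eq_conjTranspose, adjugate_conjTranspose]
  rw [← CStarRing.norm_self_mul_star, e1]
  set U := hH.eigenvectorUnitary with hU
  have hW : adjugate (U : Matrix (Fin n) (Fin n) ℂ) ∈ unitary (Matrix (Fin n) (Fin n) ℂ) := by
    rw [Unitary.mem_iff]
    constructor
    · rw [star_eq_conjTranspose, adjugate_conjTranspose, ← adjugate_mul_distrib,
        ← star_eq_conjTranspose, Unitary.mul_star_self_of_mem U.2, adjugate_one]
    · rw [star_eq_conjTranspose, adjugate_conjTranspose, ← adjugate_mul_distrib,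
        ← star_eq_conjTranspose, Unitary.star_mul_self_of_mem U.2, adjugate_one]
  conv_lhs => rw [hH.spectral_theorem, Unitary.conjStarAlgAut_apply]
  rw [adjugate_mul_distrib, adjugate_mul_distrib, star_eq_conjTranspose,
    ← adjugate_conjTranspose, ← star_eq_conjTranspose,
    CStarRing.norm_mem_unitary_mul _ (Unitary.star_mem hW),
    CStarRing.norm_mul_mem_unitary _ hW, adjugate_diagonal, l2_opNorm_diagonal]
  rfl

open scoped Matrix.Norms.L2Operator in
lemma specNorm_nonneg_aux {n : ℕ} (hn : 1 ≤ n) (A : Matrix (Fin n) (Fin n) ℂ) :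
    0 ≤ specNorm A := by
  rw [specNorm_eq_norm hn]
  exact norm_nonneg _

open scoped Matrix.Norms.L2Operator in
lemma specNorm_ne_zero_aux {n : ℕ} (hn : 1 ≤ n) (A : Matrix (Fin n) (Fin n) ℂ) (h : A ≠ 0) :
    specNorm A ≠ 0 := by
  rw [specNorm_eq_norm hn]
  exact norm_ne_zero_iff.2 h

open scoped ComplexOrder in
lemma eig_nonneg_aux {n : ℕ} (A : Matrix (Fin n) (Fin n) ℂ) (j : Fin n) :
    0 ≤ (Matrix.isHermitian_conjTranspose_mul_self A).eigenvalues j :=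
  (Matrix.posSemidef_conjTranspose_mul_self A).eigenvalues_nonneg j

/-- Lemma 5.3: if `0` is a simple eigenvalue of `A` and
`s_1 ≥ ⋯ ≥ s_n` are the singular values of `A` (the square roots of the eigenvalues of
`Aᴴ A`) in decreasing order, then `s_n = 0`, `s_{n-1} > 0`, and
`‖adj A‖ = s_1 ⋯ s_{n-1}`. -/
theorem stmt3 {n : ℕ} (hn : 1 ≤ n) (A : Matrix (Fin n) (Fin n) ℂ)
    (hsimple : Polynomial.rootMultiplicity 0 (Matrix.charpoly A) = 1)
    (s : Fin n → ℝ) (hdec : Antitone s)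
    (hs : ∃ e : Fin n ≃ Fin n, ∀ i,
      s i = Real.sqrt ((Matrix.isHermitian_conjTranspose_mul_self A).eigenvalues (e i))) :
    s ⟨n - 1, by omega⟩ = 0 ∧
    (∀ i : Fin n, (i : ℕ) < n - 1 → 0 < s i) ∧
    specNorm (Matrix.adjugate A) =
      ∏ i ∈ Finset.univ.filter (fun i : Fin n => (i : ℕ) < n - 1), s i := by
  obtain ⟨e, he⟩ := hs
  have hdet : A.det = 0 := by
    have h1 : A.charpoly.IsRoot 0 := by
      rw [← Polynomial.rootMultiplicity_pos A.charpoly_monic.ne_zero]; omega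
    have h2 := A.det_eq_sign_charpoly_coeff
    rw [Polynomial.coeff_zero_eq_eval_zero, h1.eq_zero, mul_zero] at h2
    exact h2
  have hpos : ∀ j, 0 ≤ (Matrix.isHermitian_conjTranspose_mul_self A).eigenvalues j :=
    eig_nonneg_aux A
  have hs0 : ∀ i, 0 ≤ s i := fun i => by rw [he]; exact Real.sqrt_nonneg _
  have hsq : ∀ i, (Matrix.isHermitian_conjTranspose_mul_self A).eigenvalues (e i) = s i ^ 2 :=
    fun i => by rw [he, Real.sq_sqrt (hpos _)]
  have hlast : s ⟨n - 1, by omega⟩ = 0 := by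
    have h1 := (Matrix.isHermitian_conjTranspose_mul_self A).det_eq_prod_eigenvalues
    rw [det_mul, hdet, mul_zero] at h1
    obtain ⟨j, -, hj⟩ := Finset.prod_eq_zero_iff.1 h1.symm
    have hj' : (Matrix.isHermitian_conjTranspose_mul_self A).eigenvalues j = 0 := by
      simpa using hj
    have h2 : s (e.symm j) = 0 := by rw [he]; simp [hj']
    refine le_antisymm ?_ (hs0 _)
    rw [← h2]
    apply hdec
    rw [Fin.le_def]
    have := (e.symm j).2
    simp only
    omega
  have hP0 : 0 ≤ ∏ i ∈ Finset.univ.filter (fun i : Fin n => (i : ℕ) < n - 1), s i :=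
    Finset.prod_nonneg fun i _ => hs0 i
  have key : specNorm (Matrix.adjugate A) =
      ∏ i ∈ Finset.univ.filter (fun i : Fin n => (i : ℕ) < n - 1), s i := by
    have h1 := norm_adjugate_sq A
    set i0 : Fin n := ⟨n - 1, by omega⟩ with hi0
    have h2 : (fun i => ∏ j ∈ Finset.univ.erase i,
        (((Matrix.isHermitian_conjTranspose_mul_self A).eigenvalues j : ℝ) : ℂ)) =
        Pi.single (e i0) (∏ j ∈ Finset.univ.erase (e i0),
        (((Matrix.isHermitian_conjTranspose_mul_self A).eigenvalues j : ℝ) : ℂ)) := by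
      ext i
      by_cases hi : i = e i0
      · subst hi; simp
      · rw [Pi.single_eq_of_ne hi]
        refine Finset.prod_eq_zero (i := e i0) (by simp [Ne.symm hi]) ?_
        rw [hsq, hlast]; simp
    have h3 : ∏ j ∈ Finset.univ.erase (e i0),
        (((Matrix.isHermitian_conjTranspose_mul_self A).eigenvalues j : ℝ) : ℂ) =
        (((∏ i ∈ Finset.univ.filter (fun i : Fin n => (i : ℕ) < n - 1), s i) ^ 2 : ℝ) : ℂ) := by
      rw [← Finset.prod_pow, Complex.ofReal_prod]
      symm
      refine Finset.prod_equiv e ?_ ?_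
      · intro i
        have := i.2
        simp only [Finset.mem_filter, Finset.mem_univ, true_and, Finset.mem_erase, and_true, ne_eq,
          EmbeddingLike.apply_eq_iff_eq, hi0, Fin.ext_iff]
        omega
      · intro i _
        rw [hsq]
    rw [h2, Pi.norm_single, h3, Complex.norm_real, Real.norm_of_nonneg (sq_nonneg _),
      ← specNorm_eq_norm hn, ← sq] at h1
    refine (sq_eq_sq₀ ?_ hP0).1 h1
    exact specNorm_nonneg_aux hn _
  refine ⟨hlast, ?_, key⟩
  have hne : specNorm (Matrix.adjugate A) ≠ 0 := by
    exact specNorm_ne_zero_aux hn _ (adjugate_ne_zero_of_simple hn A hsimple)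
  rw [key, Finset.prod_ne_zero_iff] at hne
  intro i hi
  exact lt_of_le_of_ne (hs0 i) (Ne.symm (hne i (by simpa using hi)))
end
end

section
/- Let P(λ) = A_m λ^m + ⋯ + A_1 λ + A_0 be an n×n complex matrix polynomial with det A_m ≠ 0 (n, m ≥ 1), and let λ_1, λ_2, …, λ_{nm} be the roots of the scalar polynomial det P(λ), listed with multiplicity. Suppose λ_i is a simple root (simple eigenvalue of P), and let x_i, y_i ∈ ℂ^n be unit right and left eigenvectors of P at λ_i. Then |y_i* P'(λ_i) x_i| · ‖adj(P(λ_i))‖ = |det A_m| · ∏_{j ≠ i} |λ_j − λ_i|, the product being over the remaining nm − 1 roots counted with multiplicity. Equivalently, for nonnegative weights w_0,…,w_m with w_0 > 0 and w(t) = Σ w_j t^j, the condition number k(P,λ_i) = w(|λ_i|)‖x_i‖‖y_i‖/|y_i* P'(λ_i) x_i| equals w(|λ_i|)·‖adj(P(λ_i))‖ / ( |det A_m| · ∏_{j≠i}|λ_j − λ_i| ). -/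
noncomputable section

open Matrix

theorem aux_jacobi {n : ℕ} (M : Matrix (Fin n) (Fin n) (Polynomial ℂ)) :
    Polynomial.derivative M.det =
      (M.adjugate * Matrix.of fun a b => Polynomial.derivative (M a b)).trace := by
  have h1 : ∀ k, (M.adjugate * Matrix.of fun a b => Polynomial.derivative (M a b)) k k =
      (M.updateCol k (fun a => Polynomial.derivative (M a k))).det := by
    intro k
    rw [← Matrix.cramer_apply, Matrix.cramer_eq_adjugate_mulVec]
    rfl
  simp only [Matrix.trace, Matrix.diag_apply, h1]
  simp only [Matrix.det_apply']
  rw [Finset.sum_comm, Polynomial.derivative_sum]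
  refine Finset.sum_congr rfl fun σ _ => ?_
  rw [← Finset.mul_sum,
    Polynomial.derivative_intCast_mul, Polynomial.derivative_prod_finset]
  congr 1
  refine Finset.sum_congr rfl fun k _ => ?_
  rw [← Finset.mul_prod_erase _ _ (Finset.mem_univ k), mul_comm]
  congr 1
  · simp
  · refine Finset.prod_congr rfl fun b hb => ?_
    rw [Matrix.updateCol_ne (Finset.ne_of_mem_erase hb)]

theorem aux_ker {n : ℕ} (M : Matrix (Fin n) (Fin n) ℂ) (i j : Fin n)
    (h : M.adjugate i j ≠ 0) (z : Fin n → ℂ) (hz : M.mulVec z = 0) (hzi : z i = 0) : z = 0 := by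
  by_contra hne
  apply h
  rw [Matrix.adjugate_apply, ← Matrix.exists_mulVec_eq_zero_iff]
  refine ⟨z, hne, ?_⟩
  ext k
  by_cases hk : k = j
  · subst hk
    simp [Matrix.mulVec, hzi]
  · have := congrFun hz k
    simpa [Matrix.mulVec, Matrix.updateRow_ne hk] using this

theorem aux_par {n : ℕ} (M : Matrix (Fin n) (Fin n) ℂ) (i j : Fin n)
    (h : M.adjugate i j ≠ 0) (x z : Fin n → ℂ) (hx : M.mulVec x = 0) (hz : M.mulVec z = 0) (a : Fin n) :
    x i * z a = z i * x a := by
  have := aux_ker M i j h (x i • z - z i • x)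
    (by simp [Matrix.mulVec_sub, Matrix.mulVec_smul, hx, hz]) (by simp [mul_comm])
  have := congrFun this a
  simpa [sub_eq_zero] using this

theorem aux_rank1 {n : ℕ} (M : Matrix (Fin n) (Fin n) ℂ) (hdet : M.det = 0)
    (hadj : M.adjugate ≠ 0) (x y : Fin n → ℂ) (hx0 : x ≠ 0) (hy0 : y ≠ 0)
    (hx : M.mulVec x = 0) (hy : Matrix.vecMul y M = 0) :
    ∃ c : ℂ, M.adjugate = c • Matrix.vecMulVec x y := by
  obtain ⟨i, j, h⟩ : ∃ i j, M.adjugate i j ≠ 0 := by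
    by_contra! hc
    exact hadj (by ext a b; simp [hc])
  have hT : Mᵀ.adjugate j i ≠ 0 := by rwa [← Matrix.adjugate_transpose]
  have hy' : Mᵀ.mulVec y = 0 := by rwa [Matrix.mulVec_transpose]
  have hxi : x i ≠ 0 := fun h0 => hx0 (aux_ker M i j h x hx h0)
  have hyj : y j ≠ 0 := fun h0 => hy0 (aux_ker Mᵀ j i hT y hy' h0)
  have hM1 : M * M.adjugate = 0 := by rw [Matrix.mul_adjugate, hdet, zero_smul]
  have hM2 : M.adjugate * M = 0 := by rw [Matrix.adjugate_mul, hdet, zero_smul]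
  refine ⟨M.adjugate i j / (x i * y j), ?_⟩
  ext a b
  have h1 := aux_par M i j h x (fun k => M.adjugate k b) hx
    (by ext k; exact congrFun (congrFun hM1 k) b) a
  have h2 := aux_par Mᵀ j i hT y (fun k => M.adjugate i k) hy'
    (by rw [Matrix.mulVec_transpose]; ext k; exact congrFun (congrFun hM2 i) k) b
  simp only [Matrix.smul_apply, Matrix.vecMulVec_apply, smul_eq_mul]
  field_simp
  linear_combination (y j) * h1 + x a * h2

theorem aux_enorm2 {n : ℕ} (x : Fin n → ℂ) : enorm2 x = ‖WithLp.toLp 2 x‖ := by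
  rw [EuclideanSpace.norm_eq]; rfl

theorem aux_smul {n : ℕ} (c : ℂ) (x : Fin n → ℂ) : enorm2 (c • x) = ‖c‖ * enorm2 x := by
  rw [aux_enorm2, aux_enorm2, WithLp.toLp_smul, norm_smul]

theorem aux_cs {n : ℕ} (x y : Fin n → ℂ) : ‖star y ⬝ᵥ x‖ ≤ enorm2 y * enorm2 x := by
  rw [aux_enorm2, aux_enorm2]
  have := norm_inner_le_norm (𝕜 := ℂ) (WithLp.toLp 2 y) (WithLp.toLp 2 x)
  rw [EuclideanSpace.inner_toLp_toLp] at this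
  rwa [dotProduct_comm]

theorem aux_self {n : ℕ} (y : Fin n → ℂ) (hy : enorm2 y = 1) : ‖star y ⬝ᵥ y‖ = 1 := by
  have := inner_self_eq_norm_sq_to_K (𝕜 := ℂ) (WithLp.toLp 2 y)
  rw [EuclideanSpace.inner_toLp_toLp, ← aux_enorm2, hy, dotProduct_comm] at this
  rw [this]; simp

theorem aux_spec {n : ℕ} (c : ℂ) (x y : Fin n → ℂ) (hx : enorm2 x = 1) (hy : enorm2 y = 1) :
    specNorm (c • Matrix.vecMulVec x (star y)) = ‖c‖ := by
  have key : ∀ v : Fin n → ℂ, enorm2 ((c • Matrix.vecMulVec x (star y)).mulVec v) =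
      ‖c‖ * ‖star y ⬝ᵥ v‖ := by
    intro v
    have : (c • Matrix.vecMulVec x (star y)).mulVec v = (c * (star y ⬝ᵥ v)) • x := by
      rw [Matrix.smul_mulVec, Matrix.vecMulVec_mulVec]
      ext k; simp; ring
    rw [this, aux_smul, hx, norm_mul, mul_one]
  unfold specNorm
  apply IsGreatest.csSup_eq
  constructor
  · exact ⟨y, hy, by rw [key, aux_self y hy, mul_one]⟩
  · rintro r ⟨v, hv, rfl⟩
    rw [key]
    have := aux_cs v y
    rw [hy, hv, one_mul] at this
    exact mul_le_of_le_one_right (norm_nonneg _) this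

/-- Theorem 5.4: for a simple eigenvalue `λ_i` of `P` with unit
right/left eigenvectors `x_i, y_i`,
`|y_i* P'(λ_i) x_i| · ‖adj(P(λ_i))‖ = |det A_m| · ∏_{j ≠ i} |λ_j − λ_i|`. -/
theorem stmt4 {n m : ℕ} (hn : 1 ≤ n) (hm : 1 ≤ m)
    (A : Fin (m+1) → Matrix (Fin n) (Fin n) ℂ)
    (hAm : (A (Fin.last m)).det ≠ 0)
    (lam : Fin (n * m) → ℂ)
    (hfact : detPoly A =
      Polynomial.C ((A (Fin.last m)).det) *
        ∏ j : Fin (n * m), (Polynomial.X - Polynomial.C (lam j)))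
    (i : Fin (n * m)) (hsimple : ∀ j, j ≠ i → lam j ≠ lam i)
    (x y : Fin n → ℂ)
    (hx1 : enorm2 x = 1) (hy1 : enorm2 y = 1)
    (hx : (evalP A (lam i)).mulVec x = 0)
    (hy : Matrix.vecMul (star y) (evalP A (lam i)) = 0) :
    ‖star y ⬝ᵥ (derivP A (lam i)).mulVec x‖ *
        specNorm (Matrix.adjugate (evalP A (lam i))) =
      ‖(A (Fin.last m)).det‖ *
        ∏ j ∈ Finset.univ.erase i, ‖lam j - lam i‖ := by
  classical
  set z := lam i with hz
  set M : Matrix (Fin n) (Fin n) (Polynomial ℂ) :=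
    Matrix.of fun i k => ∑ j : Fin (m+1), Polynomial.C (A j i k) * Polynomial.X ^ (j : ℕ) with hM
  have hdM : detPoly A = M.det := rfl
  have hev : (Polynomial.evalRingHom z).mapMatrix M = evalP A z := by
    ext a b
    simp [hM, evalP, Polynomial.eval_finsetSum, Matrix.sum_apply]
    exact Finset.sum_congr rfl fun j _ => mul_comm _ _
  have hder : (Polynomial.evalRingHom z).mapMatrix
      (Matrix.of fun a b => Polynomial.derivative (M a b)) = derivP A z := by
    ext a b
    simp [hM, derivP, Polynomial.eval_finsetSum, Matrix.sum_apply, Polynomial.derivative_X_pow]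
    refine Finset.sum_congr rfl fun j _ => ?_
    ring
  have hfact' : M.det = (Polynomial.X - Polynomial.C z) * (Polynomial.C ((A (Fin.last m)).det) *
      ∏ j ∈ Finset.univ.erase i, (Polynomial.X - Polynomial.C (lam j))) := by
    rw [← hdM, hfact, ← Finset.mul_prod_erase _ _ (Finset.mem_univ i)]
    ring
  have hdet : (evalP A z).det = 0 := by
    rw [← hev, ← RingHom.map_det, hfact']
    simp
  have htr : ((evalP A z).adjugate * derivP A z).trace =
      (A (Fin.last m)).det * ∏ j ∈ Finset.univ.erase i, (z - lam j) := by
    rw [← hev, ← hder, ← RingHom.map_adjugate, ← map_mul]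
    have h1 : ∀ B : Matrix (Fin n) (Fin n) (Polynomial ℂ),
        ((Polynomial.evalRingHom z).mapMatrix B).trace = Polynomial.evalRingHom z B.trace := by
      intro B; simp [Matrix.trace]
    rw [h1, ← aux_jacobi, hfact', Polynomial.derivative_mul]
    simp [Polynomial.eval_prod]
  have hne : (A (Fin.last m)).det * ∏ j ∈ Finset.univ.erase i, (z - lam j) ≠ 0 := by
    refine mul_ne_zero hAm (Finset.prod_ne_zero_iff.2 fun j hj => ?_)
    exact sub_ne_zero.2 (hsimple j (Finset.ne_of_mem_erase hj)).symm
  have hadj : (evalP A z).adjugate ≠ 0 := by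
    intro h
    rw [h] at htr
    exact hne (by rw [← htr]; simp)
  have hx0 : x ≠ 0 := by
    rintro rfl
    simp [enorm2] at hx1
  have hy0 : star y ≠ 0 := by
    intro h
    rw [star_eq_zero] at h
    subst h
    simp [enorm2] at hy1
  obtain ⟨c, hc⟩ := aux_rank1 _ hdet hadj x (star y) hx0 hy0 hx hy
  have htr2 : c * (star y ⬝ᵥ (derivP A z).mulVec x) =
      (A (Fin.last m)).det * ∏ j ∈ Finset.univ.erase i, (z - lam j) := by
    rw [← htr, hc, Matrix.smul_mul, Matrix.trace_smul, Matrix.vecMulVec_mul,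
      Matrix.trace_vecMulVec, Matrix.dotProduct_mulVec, dotProduct_comm, smul_eq_mul]
  rw [hc, aux_spec c x y hx1 hy1, mul_comm, ← norm_mul, htr2, norm_mul, norm_prod]
  congr 1
  exact Finset.prod_congr rfl fun j _ => norm_sub_rev _ _
end
end
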